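/- Let α ∈ [1/2, 1). Then the function p ↦ Σ_{j=1}^n p[j] log p[j] + I_α^A(p) is convex on Δ_n, where I_α^A(p) := inf over positive definite density matrices Q ∈ ℂ^{d×d} of Σ_{j=1}^n p[j] D_α(W(j)‖Q), and where 0·log 0 is interpreted as 0. (Equivalently: the negative Petz–Augustin information g_α^A(p) = −I_α^A(p) is 1-smooth relative to the negative Shannon entropy h(p) = Σ_j p[j] log p[j] on Δ_n.) -/

import Mathlib

open Matrix
open scoped ComplexOrder

/-- Matrix power of a Hermitian matrix, defined by applying `t ↦ t ^ r` (real `rpow`)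
to the eigenvalues in a spectral decomposition. Returns `0` on non-Hermitian input. -/
noncomputable def matRpow {d : ℕ} (A : Matrix (Fin d) (Fin d) ℂ) (r : ℝ) :
    Matrix (Fin d) (Fin d) ℂ :=
  if hA : A.IsHermitian then
    (hA.eigenvectorUnitary : Matrix (Fin d) (Fin d) ℂ) *
      Matrix.diagonal (fun i => ((hA.eigenvalues i ^ r : ℝ) : ℂ)) *
      (star hA.eigenvectorUnitary : Matrix (Fin d) (Fin d) ℂ)
  else 0

/-- Petz–Rényi divergence `D_α(A‖Q) = (1/(α-1)) log Tr[A^α Q^{1-α}]`. -/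
noncomputable def petzRenyiDiv {d : ℕ} (α : ℝ) (A Q : Matrix (Fin d) (Fin d) ℂ) : ℝ :=
  (1 / (α - 1)) * Real.log ((matRpow A α * matRpow Q (1 - α)).trace).re

/-- The Petz–Augustin information
`I_α^A(p) = inf_{Q positive definite density matrix} ∑ⱼ p[j] D_α(W(j)‖Q)`. -/
noncomputable def augustinInfo {n d : ℕ} (α : ℝ) (W : Fin n → Matrix (Fin d) (Fin d) ℂ)
    (p : Fin n → ℝ) : ℝ :=
  ⨅ Q : {Q : Matrix (Fin d) (Fin d) ℂ // Q.PosDef ∧ Q.trace = 1},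
    ∑ j, p j * petzRenyiDiv α (W j) (Q : Matrix (Fin d) (Fin d) ℂ)


section Aux

variable {d : ℕ}

lemma aux_cont {A : Matrix (Fin d) (Fin d) ℂ} (hA : A.IsHermitian) (f : ℝ → ℝ) :
    ContinuousOn f (spectrum ℝ A) := by
  have : (spectrum ℝ A).Finite := by
    rw [hA.spectrum_real_eq_range_eigenvalues]; exact Set.finite_range _
  exact this.continuousOn f

lemma aux_cont_image {A : Matrix (Fin d) (Fin d) ℂ} (hA : A.IsHermitian) (f g : ℝ → ℝ) :
    ContinuousOn f (g '' spectrum ℝ A) := by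
  have : (spectrum ℝ A).Finite := by
    rw [hA.spectrum_real_eq_range_eigenvalues]; exact Set.finite_range _
  exact (this.image g).continuousOn f

lemma aux_spec_nonneg {A : Matrix (Fin d) (Fin d) ℂ} (hA : A.PosSemidef) {x : ℝ}
    (hx : x ∈ spectrum ℝ A) : 0 ≤ x := by
  rw [hA.1.spectrum_real_eq_range_eigenvalues] at hx
  obtain ⟨i, rfl⟩ := hx
  exact hA.eigenvalues_nonneg i

lemma matRpow_eq_cfc {A : Matrix (Fin d) (Fin d) ℂ} (hA : A.IsHermitian) (r : ℝ) :
    matRpow A r = cfc (fun x : ℝ => x ^ r) A := by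
  rw [hA.cfc_eq, matRpow, dif_pos hA, Matrix.IsHermitian.cfc, Unitary.conjStarAlgAut_apply]
  rfl

/-- Trace of a product of two functions of Hermitian matrices, via a doubly stochastic matrix. -/
lemma aux_pair {A B : Matrix (Fin d) (Fin d) ℂ} (hA : A.IsHermitian) (hB : B.IsHermitian) :
    ∃ P : Fin d → Fin d → ℝ, (∀ i j, 0 ≤ P i j) ∧ (∀ i, ∑ j, P i j = 1) ∧
      (∀ j, ∑ i, P i j = 1) ∧ ∀ g k : ℝ → ℝ,
        (cfc g A * cfc k B).trace.re =
          ∑ i, ∑ j, P i j * (g (hA.eigenvalues i) * k (hB.eigenvalues j)) := by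
  set U := (hA.eigenvectorUnitary : Matrix (Fin d) (Fin d) ℂ) with hU
  set V := (hB.eigenvectorUnitary : Matrix (Fin d) (Fin d) ℂ) with hV
  have hUU : star U * U = 1 := Unitary.coe_star_mul_self _
  have hVV : star V * V = 1 := Unitary.coe_star_mul_self _
  have hUU' : U * star U = 1 := Unitary.coe_mul_star_self _
  have hVV' : V * star V = 1 := Unitary.coe_mul_star_self _
  set M := star U * V with hM
  have hM1 : M * star M = 1 := by
    rw [hM, star_mul, star_star]
    calc star U * V * (star V * U) = star U * (V * star V) * U := by noncomm_ring
      _ = 1 := by rw [hVV', mul_one, hUU]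
  have hM2 : star M * M = 1 := by
    rw [hM, star_mul, star_star]
    calc star V * U * (star U * V) = star V * (U * star U) * V := by noncomm_ring
      _ = 1 := by rw [hUU', mul_one, hVV]
  refine ⟨fun i j => Complex.normSq (M i j), fun i j => Complex.normSq_nonneg _, ?_, ?_, ?_⟩
  · intro i
    have := congrFun (congrFun hM1 i) i
    rw [Matrix.mul_apply, Matrix.one_apply_eq] at this
    have h2 := congrArg Complex.re this
    simp only [Complex.re_sum, Matrix.star_apply, Complex.star_def, Complex.mul_conj,
      Complex.ofReal_re, Complex.one_re] at h2
    exact h2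
  · intro i
    have := congrFun (congrFun hM2 i) i
    rw [Matrix.mul_apply, Matrix.one_apply_eq] at this
    have h2 := congrArg Complex.re this
    simp only [Complex.re_sum, Matrix.star_apply, Complex.star_def, ← Complex.normSq_eq_conj_mul_self,
      Complex.ofReal_re, Complex.one_re] at h2
    exact h2
  · intro g k
    rw [hA.cfc_eq, hB.cfc_eq, Matrix.IsHermitian.cfc, Matrix.IsHermitian.cfc,
      Unitary.conjStarAlgAut_apply, Unitary.conjStarAlgAut_apply]
    rw [← hU, ← hV]
    set D := diagonal (RCLike.ofReal ∘ g ∘ hA.eigenvalues : Fin d → ℂ) with hD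
    set E := diagonal (RCLike.ofReal ∘ k ∘ hB.eigenvalues : Fin d → ℂ) with hE
    have : (U * D * star U * (V * E * star V)).trace = (D * M * (E * star M)).trace := by
      calc (U * D * star U * (V * E * star V)).trace
          = (U * (D * star U * (V * E * star V))).trace := by congr 1; noncomm_ring
        _ = ((D * star U * (V * E * star V)) * U).trace := Matrix.trace_mul_comm _ _
        _ = _ := by rw [hM, star_mul, star_star]; congr 1; noncomm_ring
    have h3 : (U * D * star U * (V * E * star V)).trace.re = (D * M * (E * star M)).trace.re := by
      rw [this]
    refine Eq.trans h3 ?_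
    rw [Matrix.trace]
    simp only [Matrix.diag_apply, Matrix.mul_apply (M := D * M), Complex.re_sum]
    refine Finset.sum_congr rfl fun i _ => Finset.sum_congr rfl fun j _ => ?_
    rw [hD, hE, Matrix.diagonal_mul, Matrix.diagonal_mul]
    simp only [Function.comp_apply, Matrix.star_apply, Complex.star_def]
    have : ((RCLike.ofReal (g (hA.eigenvalues i)) : ℂ)) * M i j *
      ((RCLike.ofReal (k (hB.eigenvalues j)) : ℂ) * (starRingEnd ℂ) (M i j))
      = ((g (hA.eigenvalues i) * k (hB.eigenvalues j) : ℝ) : ℂ) * (M i j * (starRingEnd ℂ) (M i j)) := by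
      push_cast
      simp only [RCLike.ofReal_eq_complex_ofReal]
      ring
    rw [this, Complex.mul_conj, ← Complex.ofReal_mul, Complex.ofReal_re, mul_comm]

lemma aux_cfc_psd {A : Matrix (Fin d) (Fin d) ℂ} (hA : A.IsHermitian) (f : ℝ → ℝ)
    (hf : ∀ i, 0 ≤ f (hA.eigenvalues i)) : (cfc f A).PosSemidef := by
  rw [hA.cfc_eq, Matrix.IsHermitian.cfc, Unitary.conjStarAlgAut_apply]
  refine Matrix.PosSemidef.mul_mul_conjTranspose_same ?_ _
  refine Matrix.PosSemidef.diagonal ?_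
  intro i
  simpa using hf i

lemma matRpow_psd {A : Matrix (Fin d) (Fin d) ℂ} (hA : A.PosSemidef) (r : ℝ) :
    (matRpow A r).PosSemidef := by
  rw [matRpow_eq_cfc hA.1]
  exact aux_cfc_psd hA.1 _ fun i => Real.rpow_nonneg (hA.eigenvalues_nonneg i) _

lemma matRpow_one {A : Matrix (Fin d) (Fin d) ℂ} (hA : A.PosSemidef) : matRpow A 1 = A := by
  rw [matRpow_eq_cfc hA.1]
  simp only [Real.rpow_one]
  exact cfc_id' ℝ A hA.1.isSelfAdjoint

lemma matRpow_matRpow {A : Matrix (Fin d) (Fin d) ℂ} (hA : A.PosSemidef) (r s : ℝ) :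
    matRpow (matRpow A r) s = matRpow A (r * s) := by
  rw [matRpow_eq_cfc (matRpow_psd hA r).1, matRpow_eq_cfc hA.1, matRpow_eq_cfc hA.1,
    ← cfc_comp' (fun x : ℝ => x ^ s) (fun x : ℝ => x ^ r) A (aux_cont_image hA.1 _ _)
      (aux_cont hA.1 _) hA.1.isSelfAdjoint]
  refine cfc_congr fun x hx => ?_
  exact (Real.rpow_mul (aux_spec_nonneg hA hx) r s).symm

lemma matRpow_mul_self {A : Matrix (Fin d) (Fin d) ℂ} (hA : A.PosSemidef) {r : ℝ} (hr : 0 ≤ r) :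
    matRpow A r * A = matRpow A (r + 1) := by
  have h1 : cfc (fun x : ℝ => x) A = A := cfc_id' ℝ A hA.1.isSelfAdjoint
  rw [matRpow_eq_cfc hA.1, matRpow_eq_cfc hA.1]
  calc cfc (fun x : ℝ => x ^ r) A * A
      = cfc (fun x : ℝ => x ^ r) A * cfc (fun x : ℝ => x) A := by rw [h1]
    _ = cfc (fun x : ℝ => x ^ r * x) A :=
        (cfc_mul (fun x : ℝ => x ^ r) (fun x : ℝ => x) A (aux_cont hA.1 _) (aux_cont hA.1 _)).symm
    _ = _ := cfc_congr fun x hx =>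
        (Real.rpow_add_one' (aux_spec_nonneg hA hx) (by positivity)).symm

lemma matRpow_smul {A : Matrix (Fin d) (Fin d) ℂ} (hA : A.PosSemidef) {c : ℝ} (hc : 0 ≤ c)
    (r : ℝ) : matRpow (c • A) r = c ^ r • matRpow A r := by
  have hcA : (c • A).PosSemidef := hA.smul hc
  rw [matRpow_eq_cfc hA.1, matRpow_eq_cfc hcA.1,
    ← cfc_comp_const_mul c (fun x : ℝ => x ^ r) A (aux_cont_image hA.1 _ _) hA.1.isSelfAdjoint,
    ← cfc_const_mul (c ^ r) (fun x : ℝ => x ^ r) A (aux_cont hA.1 _)]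
  refine cfc_congr fun x hx => ?_
  exact Real.mul_rpow hc (aux_spec_nonneg hA hx)

open scoped MatrixOrder Matrix.Norms.L2Operator in
lemma matRpow_mono {A B : Matrix (Fin d) (Fin d) ℂ} (hA : A.PosSemidef) (hB : B.PosSemidef)
    (hAB : (B - A).PosSemidef) {r : ℝ} (h0 : 0 ≤ r) (h1 : r ≤ 1) :
    (matRpow B r - matRpow A r).PosSemidef := by
  have h := CFC.rpow_le_rpow (A := Matrix (Fin d) (Fin d) ℂ) (p := r) ⟨h0, h1⟩
    (a := A) (b := B) (Matrix.le_iff.2 hAB)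
  rw [CFC.rpow_eq_cfc_real hA.nonneg, CFC.rpow_eq_cfc_real hB.nonneg] at h
  rw [matRpow_eq_cfc hA.1, matRpow_eq_cfc hB.1]
  exact Matrix.le_iff.1 h

lemma aux_tr_nonneg {A B : Matrix (Fin d) (Fin d) ℂ} (hA : A.PosSemidef) (hB : B.PosSemidef) :
    0 ≤ (A * B).trace.re := by
  obtain ⟨P, hP, -, -, h⟩ := aux_pair hA.1 hB.1
  have := h id id
  rw [cfc_id ℝ A hA.1.isSelfAdjoint, cfc_id ℝ B hB.1.isSelfAdjoint] at this
  rw [this]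
  exact Finset.sum_nonneg fun i _ => Finset.sum_nonneg fun j _ =>
    mul_nonneg (hP i j) (mul_nonneg (hA.eigenvalues_nonneg i) (hB.eigenvalues_nonneg j))

lemma aux_tr_cfc {A : Matrix (Fin d) (Fin d) ℂ} (hA : A.IsHermitian) (f : ℝ → ℝ) :
    (cfc f A).trace.re = ∑ i, f (hA.eigenvalues i) := by
  rw [hA.cfc_eq, Matrix.IsHermitian.cfc, Unitary.conjStarAlgAut_apply, Matrix.trace_mul_comm,
    ← mul_assoc]
  simp [Matrix.trace]

/-- trace Young inequality -/
lemma aux_young {A B : Matrix (Fin d) (Fin d) ℂ} (hA : A.PosSemidef) (hB : B.PosSemidef)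
    {s r : ℝ} (hsr : s.HolderConjugate r) :
    (A * B).trace.re ≤ (matRpow A s).trace.re / s + (matRpow B r).trace.re / r := by
  obtain ⟨P, hP, hP1, hP2, h⟩ := aux_pair hA.1 hB.1
  have := h id id
  rw [cfc_id ℝ A hA.1.isSelfAdjoint, cfc_id ℝ B hB.1.isSelfAdjoint] at this
  rw [this, matRpow_eq_cfc hA.1, matRpow_eq_cfc hB.1, aux_tr_cfc hA.1, aux_tr_cfc hB.1]
  have e1 : (∑ i, hA.1.eigenvalues i ^ s) / s
      = ∑ i, ∑ j, P i j * (hA.1.eigenvalues i ^ s / s) := by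
    rw [Finset.sum_div]
    refine Finset.sum_congr rfl fun i _ => ?_
    rw [← Finset.sum_mul, hP1, one_mul]
  have e2 : (∑ j, hB.1.eigenvalues j ^ r) / r
      = ∑ i, ∑ j, P i j * (hB.1.eigenvalues j ^ r / r) := by
    rw [Finset.sum_div, Finset.sum_comm]
    refine Finset.sum_congr rfl fun i _ => ?_
    rw [← Finset.sum_mul, hP2, one_mul]
  rw [e1, e2, ← Finset.sum_add_distrib]
  refine Finset.sum_le_sum fun i _ => ?_
  rw [← Finset.sum_add_distrib]
  refine Finset.sum_le_sum fun j _ => ?_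
  rw [← mul_add]
  exact mul_le_mul_of_nonneg_left (Real.young_inequality_of_nonneg (hA.eigenvalues_nonneg i)
    (hB.eigenvalues_nonneg j) hsr) (hP i j)

end Aux

section Aux2

variable {n d : ℕ}

/-- Weighted sum of matrices. -/
noncomputable def auxX (A : Fin n → Matrix (Fin d) (Fin d) ℂ) (w : Fin n → ℝ) :
    Matrix (Fin d) (Fin d) ℂ := ∑ j, w j • A j

/-- Trace of the `s`-th power of the weighted sum. -/
noncomputable def auxF (A : Fin n → Matrix (Fin d) (Fin d) ℂ) (s : ℝ) (w : Fin n → ℝ) : ℝ :=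
  (matRpow (auxX A w) s).trace.re

/-- (Normalized) partial derivative of `auxF`. -/
noncomputable def auxC (A : Fin n → Matrix (Fin d) (Fin d) ℂ) (s : ℝ) (w : Fin n → ℝ)
    (j : Fin n) : ℝ := (matRpow (auxX A w) (s - 1) * A j).trace.re

variable {A : Fin n → Matrix (Fin d) (Fin d) ℂ}

lemma auxX_psd (hA : ∀ j, (A j).PosSemidef) {w : Fin n → ℝ} (hw : ∀ j, 0 ≤ w j) : (auxX A w).PosSemidef :=
  Matrix.posSemidef_sum _ fun j _ => (hA j).smul (hw j)

lemma auxX_smul (c : ℝ) (w : Fin n → ℝ) : auxX A (fun j => c * w j) = c • auxX A w := by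
  simp only [auxX, Finset.smul_sum, smul_smul]

lemma auxX_sub (v w : Fin n → ℝ) : auxX A (fun j => v j - w j) = auxX A v - auxX A w := by
  simp only [auxX, sub_smul, Finset.sum_sub_distrib]

lemma aux_tr_lin (M : Matrix (Fin d) (Fin d) ℂ) (w : Fin n → ℝ) :
    (M * auxX A w).trace.re = ∑ j, w j * (M * A j).trace.re := by
  simp only [auxX, Finset.mul_sum, Matrix.trace_sum, Complex.re_sum, Matrix.mul_smul,
    Matrix.trace_smul, Complex.smul_re, smul_eq_mul]

lemma auxC_nonneg (hA : ∀ j, (A j).PosSemidef) (s : ℝ) {w : Fin n → ℝ} (hw : ∀ j, 0 ≤ w j) (j : Fin n) : 0 ≤ auxC A s w j :=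
  aux_tr_nonneg (matRpow_psd (auxX_psd hA hw) _) (hA j)

lemma auxF_eq (hA : ∀ j, (A j).PosSemidef) {s : ℝ} (hs : 1 ≤ s) {w : Fin n → ℝ} (hw : ∀ j, 0 ≤ w j) :
    auxF A s w = ∑ j, w j * auxC A s w j := by
  have h := matRpow_mul_self (auxX_psd hA hw) (r := s - 1) (by linarith)
  rw [sub_add_cancel] at h
  rw [auxF, ← h, aux_tr_lin]
  rfl

lemma auxF_smul (hA : ∀ j, (A j).PosSemidef) (s : ℝ) {w : Fin n → ℝ} (hw : ∀ j, 0 ≤ w j) {c : ℝ} (hc : 0 ≤ c) :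
    auxF A s (fun j => c * w j) = c ^ s * auxF A s w := by
  rw [auxF, auxX_smul, matRpow_smul (auxX_psd hA hw) hc, Matrix.trace_smul, Complex.smul_re,
    smul_eq_mul]
  rfl

lemma aux_klein (hA : ∀ j, (A j).PosSemidef) {s r : ℝ} (hsr : s.HolderConjugate r) {v w : Fin n → ℝ} (hv : ∀ j, 0 ≤ v j)
    (hw : ∀ j, 0 ≤ w j) :
    auxF A s v + s * ∑ j, (w j - v j) * auxC A s v j ≤ auxF A s w := by
  have hs1 : 1 < s := hsr.lt
  have hX := auxX_psd hA hv
  have h := aux_young (matRpow_psd hX (s - 1)) (auxX_psd hA hw) hsr.symm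
  rw [matRpow_matRpow hX, hsr.sub_one_mul_conj, aux_tr_lin] at h
  have e : ∑ j, (w j - v j) * auxC A s v j
      = ∑ j, w j * (matRpow (auxX A v) (s - 1) * A j).trace.re - auxF A s v := by
    rw [auxF_eq hA hs1.le hv, ← Finset.sum_sub_distrib]
    exact Finset.sum_congr rfl fun j _ => by rw [auxC]; ring
  rw [e]
  change _ ≤ auxF A s v / r + auxF A s w / s at h
  have hr : 1 / r = 1 - 1 / s := by
    have := hsr.inv_add_inv_eq_one
    simp only [one_div]; linarith
  have hs0 : 0 < s := by linarith
  have h2 := mul_le_mul_of_nonneg_left h hs0.le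
  have e2 : s * (auxF A s v / r + auxF A s w / s) = (s - 1) * auxF A s v + auxF A s w := by
    rw [div_eq_mul_one_div, hr]
    field_simp
  rw [e2] at h2
  linarith

lemma auxC_mono (hA : ∀ j, (A j).PosSemidef) {s : ℝ} (hs1 : 1 < s) (hs2 : s ≤ 2) {w x : Fin n → ℝ} {m : ℝ} (hm : 0 ≤ m)
    (hw : ∀ j, 0 ≤ w j) (hx : ∀ j, 0 ≤ x j) (hwx : ∀ j, w j ≤ m * x j) (j : Fin n) :
    auxC A s w j ≤ m ^ (s - 1) * auxC A s x j := by
  have h1 := matRpow_mono (auxX_psd hA hw)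
    (auxX_psd hA (w := fun j => m * x j) fun j => mul_nonneg hm (hx j))
    (by rw [← auxX_sub]; exact auxX_psd hA fun j => sub_nonneg.2 (hwx j))
    (r := s - 1) (by linarith) (by linarith)
  have h2 := aux_tr_nonneg h1 (hA j)
  rw [auxX_smul, matRpow_smul (auxX_psd hA hx) hm, sub_mul, Matrix.trace_sub, Complex.sub_re,
    Matrix.smul_mul, Matrix.trace_smul, Complex.smul_re, smul_eq_mul] at h2
  rw [auxC, auxC]
  linarith

lemma aux_step (hA : ∀ j, (A j).PosSemidef) {s r : ℝ} (hsr : s.HolderConjugate r) (hs2 : s ≤ 2) {v w x : Fin n → ℝ} {m : ℝ}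
    (hm : 0 ≤ m) (hv : ∀ j, 0 ≤ v j) (hvw : ∀ j, v j ≤ w j) (hx : ∀ j, 0 ≤ x j)
    (hwx : ∀ j, w j ≤ m * x j) :
    auxF A s w ≤ auxF A s v + s * m ^ (s - 1) * ∑ j, (w j - v j) * auxC A s x j := by
  have hs1 : 1 < s := hsr.lt
  have hw : ∀ j, 0 ≤ w j := fun j => (hv j).trans (hvw j)
  have h := aux_klein hA hsr hw hv
  have h2 : ∑ j, (w j - v j) * auxC A s w j ≤ m ^ (s - 1) * ∑ j, (w j - v j) * auxC A s x j := by
    rw [Finset.mul_sum]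
    refine Finset.sum_le_sum fun j _ => ?_
    have := mul_le_mul_of_nonneg_left (auxC_mono hA hs1 hs2 hm hw hx hwx j)
      (sub_nonneg.2 (hvw j))
    linarith
  have h3 : ∑ j, (v j - w j) * auxC A s w j = -∑ j, (w j - v j) * auxC A s w j := by
    rw [← Finset.sum_neg_distrib]
    exact Finset.sum_congr rfl fun j _ => by ring
  rw [h3] at h
  have h4 := mul_le_mul_of_nonneg_left h2 (by linarith : (0 : ℝ) ≤ s)
  linarith

lemma aux_real_tangent {s r : ℝ} (hsr : s.HolderConjugate r) {a b : ℝ} (ha : 0 ≤ a) (hb : 0 ≤ b) :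
    a ^ s + s * a ^ (s - 1) * (b - a) ≤ b ^ s := by
  have hs1 : 1 < s := hsr.lt
  have hs0 : 0 < s := by linarith
  have h := Real.young_inequality_of_nonneg hb (Real.rpow_nonneg ha (s - 1)) hsr
  rw [← Real.rpow_mul ha, hsr.sub_one_mul_conj] at h
  have hr : 1 / r = 1 - 1 / s := by
    have := hsr.inv_add_inv_eq_one
    simp only [one_div]; linarith
  have h2 := mul_le_mul_of_nonneg_left h hs0.le
  have e2 : s * (b ^ s / s + a ^ s / r) = b ^ s + (s - 1) * a ^ s := by
    rw [div_eq_mul_one_div (a ^ s), hr]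
    field_simp
  have e3 : a ^ (s - 1) * a = a ^ s := by
    rw [← Real.rpow_add_one' ha (by linarith), sub_add_cancel]
  rw [e2] at h2
  have : s * a ^ (s - 1) * (b - a) = s * (b * a ^ (s - 1)) - s * a ^ s := by rw [← e3]; ring
  rw [this]
  linarith

lemma aux_star (hA : ∀ j, (A j).PosSemidef) {s r : ℝ} (hsr : s.HolderConjugate r) (hs2 : s ≤ 2) {w x : Fin n → ℝ}
    (hw : ∀ j, 0 ≤ w j) (hx : ∀ j, 0 ≤ x j) :
    auxF A s (fun j => w j * x j) ≤ ∑ j, w j ^ s * (x j * auxC A s x j) := by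
  have hs1 : 1 < s := hsr.lt
  set M : ℝ := 1 + ∑ j, w j with hM
  have hM0 : 0 < M := by have := Finset.sum_nonneg (s := Finset.univ) fun j _ => hw j; linarith
  have hwM : ∀ j, w j ≤ M := fun j => by
    have := Finset.single_le_sum (s := Finset.univ) (fun j _ => hw j) (Finset.mem_univ j)
    linarith
  set c : Fin n → ℝ := fun j => x j * auxC A s x j with hc
  have hc0 : ∀ j, 0 ≤ c j := fun j => mul_nonneg (hx j) (auxC_nonneg hA s hx j)
  set C := ∑ j, c j with hC
  have hC0 : 0 ≤ C := Finset.sum_nonneg fun j _ => hc0 j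
  have key : ∀ h : ℝ, 0 < h → ∀ k : ℕ,
      auxF A s (fun j => min (w j) (k * h) * x j) ≤
        ∑ j, (min (w j) (k * h)) ^ s * c j + s * (k * h) ^ (s - 1) * (h * C) := by
    intro h hh k
    induction k with
    | zero =>
      have e : (fun j => min (w j) ((0 : ℕ) * h) * x j) = fun j => 0 * x j := by
        funext j; simp [hw j]
      rw [e, auxF_smul hA s hx le_rfl, Real.zero_rpow (by linarith), zero_mul]
      have : ∑ j, (min (w j) ((0 : ℕ) * h)) ^ s * c j = 0 := by
        refine Finset.sum_eq_zero fun j _ => ?_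
        simp [hw j, Real.zero_rpow (by linarith : s ≠ 0)]
      rw [this]
      simp [Real.zero_rpow (by linarith : s - 1 ≠ 0)]
    | succ k ih =>
      set m : ℝ := k * h with hm
      have hm0 : 0 ≤ m := by positivity
      have hm' : ((k + 1 : ℕ) : ℝ) * h = m + h := by rw [hm]; push_cast; ring
      rw [hm']
      have st := aux_step hA hsr hs2 (v := fun j => min (w j) m * x j)
        (w := fun j => min (w j) (m + h) * x j) (x := x) (m := m + h) (by linarith)
        (fun j => mul_nonneg (le_min (hw j) hm0) (hx j))
        (fun j => mul_le_mul_of_nonneg_right (min_le_min le_rfl (by linarith)) (hx j)) hx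
        (fun j => mul_le_mul_of_nonneg_right (min_le_right _ _) (hx j))
      have e1 : ∑ j, (min (w j) (m + h) * x j - min (w j) m * x j) * auxC A s x j
          = ∑ j, (min (w j) (m + h) - min (w j) m) * c j :=
        Finset.sum_congr rfl fun j _ => by rw [hc]; ring
      rw [e1] at st
      have b1 : ∑ j, (min (w j) (m + h) - min (w j) m) * c j ≤ h * C := by
        rw [hC, Finset.mul_sum]
        refine Finset.sum_le_sum fun j _ => mul_le_mul_of_nonneg_right ?_ (hc0 j)
        rcases le_total (w j) m with h1 | h1
        · rw [min_eq_left h1, min_eq_left (by linarith)]; linarith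
        · rw [min_eq_right h1]; have := min_le_right (w j) (m + h); linarith
      have b2 : ∑ j, (min (w j) m) ^ s * c j
          + s * m ^ (s - 1) * ∑ j, (min (w j) (m + h) - min (w j) m) * c j
          ≤ ∑ j, (min (w j) (m + h)) ^ s * c j := by
        rw [Finset.mul_sum, ← Finset.sum_add_distrib]
        refine Finset.sum_le_sum fun j _ => ?_
        rw [← mul_assoc (s * m ^ (s - 1)), ← add_mul]
        refine mul_le_mul_of_nonneg_right ?_ (hc0 j)
        rcases le_total (w j) m with h1 | h1
        · rw [min_eq_left h1, min_eq_left (by linarith)]; simp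
        · rw [min_eq_right h1]
          exact aux_real_tangent hsr hm0 (le_min (hw j) (by linarith))
      have b3 : m ^ (s - 1) ≤ (m + h) ^ (s - 1) :=
        Real.rpow_le_rpow hm0 (by linarith) (by linarith)
      have b4 := mul_le_mul_of_nonneg_left b1
        (mul_nonneg (by linarith : (0 : ℝ) ≤ s) (sub_nonneg.2 b3))
      linarith
  refine le_of_forall_pos_le_add fun ε hε => ?_
  set B := s * M ^ (s - 1) * (M * C) with hB
  have hB0 : 0 ≤ B := by positivity
  obtain ⟨N, hN⟩ := exists_nat_gt (B / ε)
  have hN0 : (0 : ℝ) < N := lt_of_le_of_lt (by positivity) hN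
  have h := key (M / N) (by positivity) N
  have e : (N : ℝ) * (M / N) = M := by field_simp
  rw [e] at h
  have e2 : ∀ j, min (w j) M = w j := fun j => min_eq_left (hwM j)
  simp only [e2] at h
  refine h.trans ?_
  have : s * M ^ (s - 1) * (M / N * C) = B / N := by rw [hB]; field_simp
  rw [this]
  have : B / N ≤ ε := by
    rw [div_le_iff₀ hN0]; rw [div_lt_iff₀ hε] at hN; linarith
  linarith

/-- contraction inequality -/
lemma aux_contract (hA : ∀ j, (A j).PosSemidef) {s r : ℝ} (hsr : s.HolderConjugate r) (hs2 : s ≤ 2) {x : Fin n → ℝ}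
    (hx : ∀ j, 0 ≤ x j) {τ : Matrix (Fin d) (Fin d) ℂ} (hτ : τ.PosSemidef) :
    ∑ j, x j * auxC A s x j * ((τ * A j).trace.re / auxC A s x j) ^ r
      ≤ (matRpow τ r).trace.re := by
  have hs1 : 1 < s := hsr.lt
  have hr1 : 1 < r := hsr.symm.lt
  have hc0 := auxC_nonneg hA s hx
  set v : Fin n → ℝ := fun j => (τ * A j).trace.re / auxC A s x j with hv
  have hv0 : ∀ j, 0 ≤ v j := fun j => div_nonneg (aux_tr_nonneg hτ (hA j)) (hc0 j)
  have hw0 : ∀ j, 0 ≤ v j ^ (r - 1) := fun j => Real.rpow_nonneg (hv0 j) _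
  have hy := aux_young hτ (auxX_psd hA (w := fun j => v j ^ (r - 1) * x j)
    fun j => mul_nonneg (hw0 j) (hx j)) hsr.symm
  have hst := aux_star hA hsr hs2 hw0 hx
  rw [aux_tr_lin] at hy
  set T := ∑ j, x j * auxC A s x j * v j ^ r with hT
  have e1 : ∑ j, (v j ^ (r - 1)) ^ s * (x j * auxC A s x j) = T := by
    refine Finset.sum_congr rfl fun j _ => ?_
    rw [← Real.rpow_mul (hv0 j), hsr.symm.sub_one_mul_conj]; ring
  rw [e1] at hst
  have e2 : T ≤ ∑ j, v j ^ (r - 1) * x j * (τ * A j).trace.re := by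
    refine Finset.sum_le_sum fun j _ => ?_
    have : v j ^ r = v j ^ (r - 1) * v j := by
      rw [← Real.rpow_add_one' (hv0 j) (by linarith), sub_add_cancel]
    rw [this]
    have h3 : auxC A s x j * v j ≤ (τ * A j).trace.re := by
      rcases (hc0 j).eq_or_lt with h | h
      · rw [← h, zero_mul]; exact aux_tr_nonneg hτ (hA j)
      · exact le_of_eq (mul_div_cancel₀ _ h.ne')
    have := mul_le_mul_of_nonneg_left h3 (mul_nonneg (hw0 j) (hx j))
    linarith
  change _ ≤ _ + auxF A s _ / s at hy
  have e3 : T ≤ (matRpow τ r).trace.re / r + T / s :=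
    (e2.trans hy).trans (by gcongr)
  have hs : 1 / s = 1 - 1 / r := by
    have := hsr.inv_add_inv_eq_one
    simp only [one_div]; linarith
  rw [div_eq_mul_one_div T, hs] at e3
  have e4 : T * (1 / r) ≤ (matRpow τ r).trace.re * (1 / r) := by
    rw [← div_eq_mul_one_div (matRpow τ r).trace.re]; linarith
  exact le_of_mul_le_mul_right e4 (by positivity)

end Aux2

section Aux3

variable {n d : ℕ}

lemma aux_optimum {A : Fin n → Matrix (Fin d) (Fin d) ℂ} (hA : ∀ j, (A j).PosSemidef) {s r : ℝ}
    (hsr : s.HolderConjugate r) (hs2 : s ≤ 2) (hA1 : ∀ j, (matRpow (A j) s).trace.re = 1)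
    {p : Fin n → ℝ} (hp : p ∈ stdSimplex ℝ (Fin n)) :
    ∃ x : Fin n → ℝ, (∀ j, 0 ≤ x j) ∧ auxF A s x ≤ 1 ∧ ∀ j, p j ≤ x j * auxC A s x j := by
  have hs1 : 1 < s := hsr.lt
  have hs0 : 0 < s := by linarith
  set K : Set (Fin n → ℝ) := {x | (∀ j, 0 ≤ x j) ∧ auxF A s x ≤ 1} with hK
  -- monotonicity
  have hmono : ∀ v w : Fin n → ℝ, (∀ j, 0 ≤ v j) → (∀ j, v j ≤ w j) →
      auxF A s v ≤ auxF A s w := by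
    intro v w hv hvw
    have h := aux_klein hA hsr hv (w := w) (fun j => (hv j).trans (hvw j))
    have h2 : 0 ≤ ∑ j, (w j - v j) * auxC A s v j := Finset.sum_nonneg fun j _ =>
      mul_nonneg (sub_nonneg.2 (hvw j)) (auxC_nonneg hA s hv j)
    have := mul_nonneg hs0.le h2
    linarith
  have hKeq : K = (⋂ j, {x : Fin n → ℝ | 0 ≤ x j}) ∩ ⋂ y : {y : Fin n → ℝ // ∀ j, 0 ≤ y j},
      {x : Fin n → ℝ | auxF A s y.1 + s * ∑ j, (x j - y.1 j) * auxC A s y.1 j ≤ 1} := by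
    ext x
    simp only [hK, Set.mem_ofPred_eq, Set.mem_inter_iff, Set.mem_iInter]
    constructor
    · rintro ⟨h1, h2⟩
      exact ⟨h1, fun y => (aux_klein hA hsr y.2 h1).trans h2⟩
    · rintro ⟨h1, h2⟩
      refine ⟨h1, ?_⟩
      simpa using h2 ⟨x, h1⟩
  have hKclosed : IsClosed K := by
    rw [hKeq]
    refine IsClosed.inter (isClosed_iInter fun j => ?_) (isClosed_iInter fun y => ?_)
    · exact isClosed_le continuous_const (continuous_apply j)
    · exact isClosed_le (by fun_prop) continuous_const
  have hKsub : K ⊆ Set.Icc (fun _ => 0) (fun _ => 1) := by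
    rintro x ⟨h1, h2⟩
    refine ⟨h1, fun j => ?_⟩
    have h3 := hmono (fun i => x j * (if i = j then 1 else 0)) x
      (fun i => by split_ifs <;> simp [h1]) (fun i => by split_ifs with h <;> simp [h, h1])
    rw [auxF_smul hA s (fun i => by split_ifs <;> simp) (h1 j)] at h3
    have h4 : auxF A s (fun i => if i = j then 1 else 0) = 1 := by
      have : auxX A (fun i => if i = j then 1 else 0) = A j := by simp [auxX]
      rw [auxF, this, hA1 j]
    rw [h4, mul_one] at h3
    by_contra h5
    have := Real.one_lt_rpow (not_le.1 h5) hs0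
    linarith
  have hKc : IsCompact K := (isCompact_Icc).of_isClosed_subset hKclosed hKsub
  have h0K : (fun _ => 0 : Fin n → ℝ) ∈ K := by
    refine ⟨fun _ => le_rfl, ?_⟩
    have := auxF_smul hA s (w := fun _ => (0 : ℝ)) (fun _ => le_rfl) (le_refl (0 : ℝ))
    rw [Real.zero_rpow hs0.ne', zero_mul] at this
    rw [this, zero_mul]; exact zero_le_one
  have hcont : Continuous fun x : Fin n → ℝ => ∏ j, x j ^ p j :=
    continuous_finsetProd _ fun j _ => (continuous_apply j).rpow_const fun _ => Or.inr (hp.1 j)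
  obtain ⟨x, ⟨hx0, hx1⟩, hxmax⟩ := hKc.exists_isMaxOn ⟨_, h0K⟩ hcont.continuousOn
  -- positivity of the maximum
  have hpos : 0 < ∏ j, x j ^ p j := by
    have hF0 : 0 ≤ auxF A s (fun _ => 1) := by
      rw [auxF_eq hA hs1.le (fun _ => zero_le_one)]
      exact Finset.sum_nonneg fun j _ => by
        rw [one_mul]; exact auxC_nonneg hA s (fun _ => zero_le_one) j
    set ε : ℝ := 1 / (auxF A s (fun _ => 1) + 1) with hε
    have hε0 : 0 < ε := by positivity
    have hε1 : ε ≤ 1 := by rw [hε, div_le_one (by linarith)]; linarith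
    have hmem : (fun j : Fin n => ε * (1 : ℝ)) ∈ K := by
      refine ⟨fun _ => by positivity, ?_⟩
      rw [auxF_smul hA s (w := fun _ => (1 : ℝ)) (fun _ => zero_le_one) hε0.le]
      have h1 : ε ^ s ≤ ε := by
        calc ε ^ s ≤ ε ^ (1 : ℝ) := Real.rpow_le_rpow_of_exponent_ge hε0 hε1 hs1.le
          _ = ε := Real.rpow_one ε
      calc ε ^ s * auxF A s (fun _ => 1) ≤ ε * auxF A s (fun _ => 1) :=
            mul_le_mul_of_nonneg_right h1 hF0
        _ ≤ ε * (auxF A s (fun _ => 1) + 1) := by gcongr; linarith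
        _ = 1 := by rw [hε]; field_simp
    have h2 := hxmax hmem
    refine lt_of_lt_of_le ?_ h2
    exact Finset.prod_pos fun j _ => Real.rpow_pos_of_pos (by positivity) _
  refine ⟨x, hx0, hx1, fun j => ?_⟩
  have hcj := auxC_nonneg hA s hx0 j
  rcases (hp.1 j).eq_or_lt with hpj | hpj
  · rw [← hpj]; exact mul_nonneg (hx0 j) hcj
  have hxj : 0 < x j := by
    rcases (hx0 j).eq_or_lt with h | h
    · exfalso
      have : ∏ j, x j ^ p j = 0 := Finset.prod_eq_zero (Finset.mem_univ j) (by
        rw [← h, Real.zero_rpow hpj.ne'])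
      linarith
    · exact h
  set q := x j * auxC A s x j with hq
  have hq0 : 0 ≤ q := mul_nonneg (hx0 j) hcj
  have main : ∀ δ : ℝ, 0 < δ → p j ≤ (1 + δ) ^ s * q := by
    intro δ hδ
    set e : Fin n → ℝ := fun i => if i = j then 1 + δ else 1 with he
    have he1 : ∀ i, 1 ≤ e i := fun i => by simp only [he]; split_ifs <;> linarith
    have he2 : ∀ i, e i ≤ 1 + δ := fun i => by simp only [he]; split_ifs <;> linarith
    have he0 : ∀ i, 0 ≤ e i := fun i => zero_le_one.trans (he1 i)
    set y : Fin n → ℝ := fun i => e i * x i with hy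
    have hy0 : ∀ i, 0 ≤ y i := fun i => mul_nonneg (he0 i) (hx0 i)
    have st := aux_step hA hsr hs2 (v := x) (w := y) (x := x) (m := 1 + δ) (by linarith) hx0
      (fun i => le_mul_of_one_le_left (hx0 i) (he1 i)) hx0
      (fun i => mul_le_mul_of_nonneg_right (he2 i) (hx0 i))
    have e1 : ∑ i, (y i - x i) * auxC A s x i = δ * q := by
      rw [Finset.sum_eq_single j]
      · simp only [hy, he, if_true]; rw [hq]; ring
      · intro i _ hij
        simp [hy, he, hij]
      · simp
    rw [e1] at st
    set η := s * (1 + δ) ^ (s - 1) * (δ * q) with hη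
    have hη0 : 0 ≤ η := by positivity
    have hFy : auxF A s y ≤ 1 + η := by linarith
    set κ : ℝ := (1 + η) ^ (-(1 / s)) with hκ
    have hκ0 : 0 < κ := Real.rpow_pos_of_pos (by linarith) _
    have hmem : (fun i => κ * y i) ∈ K := by
      refine ⟨fun i => mul_nonneg hκ0.le (hy0 i), ?_⟩
      rw [auxF_smul hA s hy0 hκ0.le, hκ, ← Real.rpow_mul (by linarith)]
      have : -(1 / s) * s = -1 := by field_simp
      rw [this, Real.rpow_neg_one, inv_mul_le_iff₀ (by linarith)]
      linarith
    have h2 : ∏ i, (κ * y i) ^ p i ≤ ∏ i, x i ^ p i := hxmax hmem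
    have e2 : ∏ i, (κ * y i) ^ p i = κ * ((1 + δ) ^ p j * ∏ i, x i ^ p i) := by
      have : ∀ i, (κ * y i) ^ p i = κ ^ p i * (e i ^ p i * x i ^ p i) := fun i => by
        rw [Real.mul_rpow hκ0.le (hy0 i), Real.mul_rpow (he0 i) (hx0 i)]
      simp only [this, Finset.prod_mul_distrib]
      rw [← Real.rpow_sum_of_pos hκ0, hp.2, Real.rpow_one]
      congr 2
      rw [Finset.prod_eq_single j]
      · simp [he]
      · intro i _ hij; simp [he, hij]
      · simp
    rw [e2, ← mul_assoc] at h2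
    have h3 : κ * (1 + δ) ^ p j ≤ 1 := by
      by_contra h
      have := mul_lt_mul_of_pos_right (not_le.1 h) hpos
      linarith
    have h4 := Real.log_le_log (mul_pos hκ0 (Real.rpow_pos_of_pos (by linarith) _)) h3
    rw [Real.log_one, Real.log_mul hκ0.ne' (Real.rpow_pos_of_pos (by linarith) _).ne', hκ,
      Real.log_rpow (by linarith), Real.log_rpow (by linarith)] at h4
    have h5 : Real.log (1 + η) ≤ η := by
      have := Real.log_le_sub_one_of_pos (by linarith : 0 < 1 + η); linarith
    have h6 : δ / (1 + δ) ≤ Real.log (1 + δ) := by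
      have := Real.one_sub_inv_le_log_of_pos (by linarith : 0 < 1 + δ)
      have e : δ / (1 + δ) = 1 - (1 + δ)⁻¹ := by field_simp; ring
      rw [e]; exact this
    have h7 : p j * (δ / (1 + δ)) ≤ (1 / s) * η := by
      have a1 := mul_le_mul_of_nonneg_left h6 hpj.le
      have a2 := mul_le_mul_of_nonneg_left h5 (by positivity : (0 : ℝ) ≤ 1 / s)
      linarith
    have e3 : (1 / s) * η = (1 + δ) ^ (s - 1) * (δ * q) := by rw [hη]; field_simp
    have e4 : (1 + δ) ^ s = (1 + δ) ^ (s - 1) * (1 + δ) := by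
      rw [← Real.rpow_add_one (by linarith), sub_add_cancel]
    rw [e3] at h7
    have h8 := mul_le_mul_of_nonneg_right h7 (by positivity : 0 ≤ (1 + δ) / δ)
    have e5 : p j * (δ / (1 + δ)) * ((1 + δ) / δ) = p j := by field_simp
    have e6 : (1 + δ) ^ (s - 1) * (δ * q) * ((1 + δ) / δ) = (1 + δ) ^ s * q := by
      rw [e4]; field_simp
    rwa [e5, e6] at h8
  have hlim : Filter.Tendsto (fun δ : ℝ => (1 + δ) ^ s * q) (nhdsWithin 0 (Set.Ioi 0))
      (nhds ((1 + 0) ^ s * q)) := by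
    have : Continuous fun δ : ℝ => (1 + δ) ^ s * q :=
      ((continuous_const.add continuous_id).rpow_const fun _ => Or.inr hs0.le).mul continuous_const
    exact (this.tendsto 0).mono_left nhdsWithin_le_nhds
  have := ge_of_tendsto hlim (Filter.eventually_of_mem self_mem_nhdsWithin main)
  simpa using this

/-- positivity of the Petz quantity -/
lemma aux_petz_pos {W Q : Matrix (Fin d) (Fin d) ℂ} (hW : W.PosSemidef) (hW1 : W.trace = 1)
    (hQ : Q.PosDef) (a b : ℝ) : 0 < (matRpow W a * matRpow Q b).trace.re := by
  obtain ⟨P, hP, hP1, hP2, h⟩ := aux_pair hW.1 hQ.1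
  rw [matRpow_eq_cfc hW.1, matRpow_eq_cfc hQ.1, h]
  have hw : ∃ i, 0 < hW.1.eigenvalues i := by
    by_contra hcon
    push Not at hcon
    have h1 := aux_tr_cfc hW.1 id
    rw [cfc_id ℝ W hW.1.isSelfAdjoint, hW1, Complex.one_re] at h1
    have : ∑ i, id (hW.1.eigenvalues i) ≤ 0 := Finset.sum_nonpos fun i _ => hcon i
    linarith
  obtain ⟨i, hi⟩ := hw
  have hj : ∃ j, 0 < P i j := by
    by_contra hcon
    push Not at hcon
    have : ∑ j, P i j ≤ 0 := Finset.sum_nonpos fun j _ => hcon j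
    rw [hP1] at this
    linarith
  obtain ⟨j, hj⟩ := hj
  have hnn : ∀ i j, 0 ≤ P i j * (hW.1.eigenvalues i ^ a * hQ.1.eigenvalues j ^ b) := fun i j =>
    mul_nonneg (hP i j) (mul_nonneg (Real.rpow_nonneg (hW.eigenvalues_nonneg i) _)
      (Real.rpow_nonneg (hQ.eigenvalues_pos j).le _))
  refine Finset.sum_pos' (fun i _ => Finset.sum_nonneg fun j _ => hnn i j)
    ⟨i, Finset.mem_univ i, Finset.sum_pos' (fun j _ => hnn i j) ⟨j, Finset.mem_univ j, ?_⟩⟩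
  exact mul_pos hj (mul_pos (Real.rpow_pos_of_pos hi _)
    (Real.rpow_pos_of_pos (hQ.eigenvalues_pos j) _))

lemma aux_trace_real {A : Matrix (Fin d) (Fin d) ℂ} (hA : A.PosSemidef) :
    A.trace = (A.trace.re : ℂ) := by
  have := (Complex.nonneg_iff.1 hA.trace_nonneg).2
  exact Complex.ext rfl (by simp [← this])

/-- Tangent (subgradient) statement at a point `p`. -/
lemma aux_tangent (hd : 0 < d) {α : ℝ} (hα : α ∈ Set.Ico (1 / 2 : ℝ) 1)
    {W : Fin n → Matrix (Fin d) (Fin d) ℂ} (hW : ∀ j, (W j).PosSemidef ∧ (W j).trace = 1)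
    {p : Fin n → ℝ} (hp : p ∈ stdSimplex ℝ (Fin n)) :
    ∃ l : Fin n → ℝ,
      (∑ j, p j * Real.log (p j)) + augustinInfo α W p ≤ ∑ j, p j * l j ∧
      ∀ q ∈ stdSimplex ℝ (Fin n), (∀ j, p j = 0 → q j = 0) →
        ∑ j, q j * l j ≤ (∑ j, q j * Real.log (q j)) + augustinInfo α W q := by
  obtain ⟨hα1, hα2⟩ := hα
  have hα0 : 0 < α := by linarith
  have hβ0 : 0 < 1 - α := by linarith
  set r : ℝ := 1 / (1 - α) with hr
  set s : ℝ := 1 / α with hs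
  have hsr : s.HolderConjugate r := by
    rw [Real.holderConjugate_iff]
    refine ⟨by rw [hs, lt_div_iff₀ hα0]; linarith, by rw [hs, hr]; simp⟩
  have hs2 : s ≤ 2 := by rw [hs, div_le_iff₀ hα0]; linarith
  have hs1 : 1 < s := hsr.lt
  have hr1 : 1 < r := hsr.symm.lt
  set A : Fin n → Matrix (Fin d) (Fin d) ℂ := fun j => matRpow (W j) α with hAdef
  have hA : ∀ j, (A j).PosSemidef := fun j => matRpow_psd (hW j).1 _
  have hA1 : ∀ j, (matRpow (A j) s).trace.re = 1 := fun j => by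
    simp only [hAdef]
    rw [matRpow_matRpow (hW j).1, hs, mul_one_div_cancel hα0.ne', matRpow_one (hW j).1, (hW j).2,
      Complex.one_re]
  obtain ⟨x, hx0, hx1, hxp⟩ := aux_optimum hA hsr hs2 hA1 hp
  set c := auxC A s x with hc
  have hc0 : ∀ j, 0 ≤ c j := auxC_nonneg hA s hx0
  have hcpos : ∀ j, 0 < p j → 0 < c j := fun j hj => by
    rcases (hc0 j).eq_or_lt with h | h
    · have := hxp j; rw [← h, mul_zero] at this; linarith
    · exact h
  have hdiv : ∀ j (Q : Matrix (Fin d) (Fin d) ℂ), petzRenyiDiv α (W j) Q =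
      -r * Real.log (A j * matRpow Q (1 - α)).trace.re := fun j Q => by
    rw [petzRenyiDiv, hr]
    congr 1
    rw [← neg_sub 1 α, ← neg_div_neg_eq]; simp [neg_div]
  -- lower bound for each Q
  have lower : ∀ q ∈ stdSimplex ℝ (Fin n), (∀ j, p j = 0 → q j = 0) →
      ∀ Q : {Q : Matrix (Fin d) (Fin d) ℂ // Q.PosDef ∧ Q.trace = 1},
        ∑ j, q j * (Real.log (p j) - r * Real.log (c j)) - ∑ j, q j * Real.log (q j) ≤
          ∑ j, q j * petzRenyiDiv α (W j) Q.1 := by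
    intro q hq hpq Q
    set τ := matRpow Q.1 (1 - α) with hτ
    have hτp : τ.PosSemidef := matRpow_psd Q.2.1.posSemidef _
    have hτ1 : (matRpow τ r).trace.re = 1 := by
      rw [hτ, matRpow_matRpow Q.2.1.posSemidef, hr, mul_one_div_cancel hβ0.ne',
        matRpow_one Q.2.1.posSemidef, Q.2.2, Complex.one_re]
    have hT : ∀ j, 0 < (A j * τ).trace.re := fun j =>
      aux_petz_pos (hW j).1 (hW j).2 Q.2.1 _ _
    have hct := aux_contract hA hsr hs2 hx0 hτp
    rw [hτ1] at hct
    set u : Fin n → ℝ := fun j => ((A j * τ).trace.re / c j) ^ r with hu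
    have hu0 : ∀ j, 0 ≤ u j := fun j => Real.rpow_nonneg (div_nonneg (hT j).le (hc0 j)) _
    have hpu : ∑ j, p j * u j ≤ 1 := by
      refine le_trans (Finset.sum_le_sum fun j _ => ?_) hct
      rw [Matrix.trace_mul_comm τ]
      exact mul_le_mul_of_nonneg_right (hxp j) (hu0 j)
    have hkey : 0 ≤ ∑ j, (q j * petzRenyiDiv α (W j) Q.1 -
        (q j * (Real.log (p j) - r * Real.log (c j)) - q j * Real.log (q j))) := by
      have h1 : 0 ≤ ∑ j, (q j - p j * u j) := by
        rw [Finset.sum_sub_distrib, hq.2]; linarith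
      refine h1.trans (Finset.sum_le_sum fun j _ => ?_)
      rcases (hq.1 j).eq_or_lt with h | h
      · rw [← h]; simp only [zero_mul, sub_zero, zero_sub]
        have := mul_nonneg (hp.1 j) (hu0 j)
        linarith
      · have hpj : 0 < p j := lt_of_le_of_ne (hp.1 j) fun h0 => h.ne' (hpq j h0.symm)
        have hcj := hcpos j hpj
        have huj : 0 < u j := Real.rpow_pos_of_pos (div_pos (hT j) hcj) _
        have hlu : Real.log (u j) = r * (Real.log (A j * τ).trace.re - Real.log (c j)) := by
          simp only [hu]
          rw [Real.log_rpow (div_pos (hT j) hcj), Real.log_div (hT j).ne' hcj.ne']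
        have h3 := Real.log_le_sub_one_of_pos (div_pos (mul_pos hpj huj) h)
        rw [Real.log_div (mul_pos hpj huj).ne' h.ne', Real.log_mul hpj.ne' huj.ne', hlu] at h3
        have h4 := mul_le_mul_of_nonneg_left h3 h.le
        have e : q j * (p j * u j / q j - 1) = p j * u j - q j := by field_simp
        rw [e] at h4
        rw [hdiv]
        linarith
    rw [Finset.sum_sub_distrib, Finset.sum_sub_distrib] at hkey
    linarith
  have hne : Nonempty {Q : Matrix (Fin d) (Fin d) ℂ // Q.PosDef ∧ Q.trace = 1} := by
    refine ⟨⟨((1 / d : ℝ)) • (1 : Matrix (Fin d) (Fin d) ℂ), Matrix.PosDef.one.smul (by positivity),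
      ?_⟩⟩
    rw [Matrix.trace_smul, Matrix.trace_one]
    have : (d : ℂ) ≠ 0 := by exact_mod_cast hd.ne'
    simp [this]
  refine ⟨fun j => Real.log (p j) - r * Real.log (c j), ?_, fun q hq hpq => ?_⟩
  · have hbdd : BddBelow (Set.range fun Q : {Q : Matrix (Fin d) (Fin d) ℂ // Q.PosDef ∧ Q.trace = 1}
        => ∑ j, p j * petzRenyiDiv α (W j) Q.1) :=
      ⟨_, by rintro _ ⟨Q, rfl⟩; exact lower p hp (fun _ h => h) Q⟩
    set X := auxX A x with hX
    have hXp : X.PosSemidef := auxX_psd hA hx0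
    have hXs : (matRpow X s).PosSemidef := matRpow_psd hXp s
    set t := (matRpow X s).trace.re with ht
    have ht1 : t ≤ 1 := hx1
    have ht0 : 0 ≤ t := (Complex.nonneg_iff.1 hXs.trace_nonneg).1
    have hmain : ∀ ε : ℝ, 0 < ε → ε < 1 → augustinInfo α W p ≤
        ∑ j, p j * (-r * Real.log (c j)) - Real.log (1 - ε) := by
      intro ε hε0 hε1
      have hd' : (0 : ℝ) < d := by exact_mod_cast hd
      set z : ℝ := (1 - (1 - ε) * t) / d with hz
      have hz0 : 0 < z := by
        refine div_pos ?_ hd'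
        have := mul_le_mul_of_nonneg_left ht1 (by linarith : 0 ≤ 1 - ε)
        linarith
      set Y := (1 - ε) • matRpow X s with hY
      have hYp : Y.PosSemidef := hXs.smul (by linarith : 0 ≤ 1 - ε)
      set Q := Y + z • (1 : Matrix (Fin d) (Fin d) ℂ) with hQ
      have hzp : (z • (1 : Matrix (Fin d) (Fin d) ℂ)).PosDef := Matrix.PosDef.one.smul hz0
      have hQp : Q.PosDef := Matrix.PosDef.posSemidef_add hYp hzp
      have hQ1 : Q.trace = 1 := by
        rw [hQ, hY, Matrix.trace_add, Matrix.trace_smul, Matrix.trace_smul, Matrix.trace_one,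
          aux_trace_real hXs, ← ht]
        have : (1 - ε) * t + z * d = 1 := by rw [hz]; field_simp; ring
        have h2 := congrArg (fun a : ℝ => (a : ℂ)) this
        simp only [Fintype.card_fin, Complex.real_smul]
        push_cast at h2 ⊢
        exact h2
      have hinf : augustinInfo α W p ≤ ∑ j, p j * petzRenyiDiv α (W j) Q :=
        ciInf_le hbdd ⟨Q, hQp, hQ1⟩
      refine hinf.trans ?_
      have hmn := matRpow_mono hYp hQp.posSemidef (by
        rw [hQ, add_sub_cancel_left]; exact hzp.posSemidef) hβ0.le (by linarith : 1 - α ≤ 1)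
      have hYe : matRpow Y (1 - α) = (1 - ε) ^ (1 - α) • matRpow X (s - 1) := by
        rw [hY, matRpow_smul hXs (by linarith), matRpow_matRpow hXp]
        congr 2
        rw [hs]; field_simp
      have hcmp : ∀ j, (1 - ε) ^ (1 - α) * c j ≤ (A j * matRpow Q (1 - α)).trace.re := fun j => by
        have h := aux_tr_nonneg hmn (hA j)
        rw [hYe, sub_mul, Matrix.trace_sub, Complex.sub_re, Matrix.smul_mul, Matrix.trace_smul,
          Complex.smul_re, smul_eq_mul] at h
        rw [Matrix.trace_mul_comm (A j)]
        change 0 ≤ _ - _ * c j at h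
        linarith
      have e1 : ∑ j, p j * (-r * Real.log (c j)) - Real.log (1 - ε)
          = ∑ j, p j * (-r * Real.log (c j) - Real.log (1 - ε)) := by
        simp only [mul_sub, Finset.sum_sub_distrib, ← Finset.sum_mul, hp.2, one_mul]
      rw [e1]
      refine Finset.sum_le_sum fun j _ => ?_
      rcases (hp.1 j).eq_or_lt with h | h
      · rw [← h]; simp
      · refine mul_le_mul_of_nonneg_left ?_ h.le
        have hcj := hcpos j h
        have hεp : 0 < (1 - ε) ^ (1 - α) := Real.rpow_pos_of_pos (by linarith) _
        have h2 := Real.log_le_log (mul_pos hεp hcj) (hcmp j)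
        rw [Real.log_mul hεp.ne' hcj.ne', Real.log_rpow (by linarith)] at h2
        have h3 := mul_le_mul_of_nonneg_left h2 (by linarith : 0 ≤ r)
        have e : r * ((1 - α) * Real.log (1 - ε) + Real.log (c j))
            = Real.log (1 - ε) + r * Real.log (c j) := by
          rw [hr]; field_simp
        rw [e] at h3
        rw [hdiv]
        linarith
    have hlim : Filter.Tendsto (fun ε : ℝ => ∑ j, p j * (-r * Real.log (c j)) - Real.log (1 - ε))
        (nhdsWithin 0 (Set.Ioi 0)) (nhds (∑ j, p j * (-r * Real.log (c j)) - Real.log (1 - 0))) := by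
      have : ContinuousAt (fun ε : ℝ => ∑ j, p j * (-r * Real.log (c j)) - Real.log (1 - ε)) 0 :=
        continuousAt_const.sub ((continuousAt_const.sub continuousAt_id).log (by norm_num))
      exact this.tendsto.mono_left nhdsWithin_le_nhds
    have hfin := ge_of_tendsto hlim (by
      filter_upwards [Ioo_mem_nhdsGT (zero_lt_one : (0 : ℝ) < 1)] with ε hε
      exact hmain ε hε.1 hε.2)
    rw [sub_zero, Real.log_one, sub_zero] at hfin
    have e : ∑ j, p j * (Real.log (p j) - r * Real.log (c j))
        = ∑ j, p j * Real.log (p j) + ∑ j, p j * (-r * Real.log (c j)) := by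
      rw [← Finset.sum_add_distrib]
      exact Finset.sum_congr rfl fun j _ => by ring
    rw [e]
    linarith
  · have h : ∑ j, q j * (Real.log (p j) - r * Real.log (c j)) - ∑ j, q j * Real.log (q j) ≤
        augustinInfo α W q := le_ciInf fun Q => lower q hq hpq Q
    linarith

end Aux3

/-- for α ∈ [1/2, 1), the map `p ↦ ∑ⱼ p[j] log p[j] + I_α^A(p)` is convex
on the simplex; equivalently, `-I_α^A` is 1-smooth relative to the negative Shannon
entropy on the simplex. -/
theorem augustin_relative_smoothness {n d : ℕ} (hn : 0 < n) (hd : 0 < d) (α : ℝ)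
    (hα : α ∈ Set.Ico (1 / 2 : ℝ) 1)
    (W : Fin n → Matrix (Fin d) (Fin d) ℂ)
    (hW : ∀ j, (W j).PosSemidef ∧ (W j).trace = 1) :
    ConvexOn ℝ (stdSimplex ℝ (Fin n))
      (fun p : Fin n → ℝ => (∑ j, p j * Real.log (p j)) + augustinInfo α W p) := by
  refine ⟨convex_stdSimplex ℝ (Fin n), ?_⟩
  intro x hx y hy a b ha hb hab
  rcases ha.eq_or_lt with rfl | ha'
  · have : b = 1 := by linarith
    subst this
    simp
  rcases hb.eq_or_lt with rfl | hb'
  · have : a = 1 := by linarith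
    subst this
    simp
  have hp : a • x + b • y ∈ stdSimplex ℝ (Fin n) := convex_stdSimplex ℝ (Fin n) hx hy ha hb hab
  obtain ⟨l, h1, h2⟩ := aux_tangent hd hα hW hp
  have hz : ∀ j, (a • x + b • y) j = 0 → x j = 0 ∧ y j = 0 := by
    intro j hj
    simp only [Pi.add_apply, Pi.smul_apply, smul_eq_mul] at hj
    have hxj := mul_nonneg ha (hx.1 j)
    have hyj := mul_nonneg hb (hy.1 j)
    have e1 : a * x j = 0 := by linarith
    have e2 : b * y j = 0 := by linarith
    exact ⟨(mul_eq_zero.1 e1).resolve_left ha'.ne', (mul_eq_zero.1 e2).resolve_left hb'.ne'⟩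
  have hx2 := h2 x hx fun j hj => (hz j hj).1
  have hy2 := h2 y hy fun j hj => (hz j hj).2
  refine h1.trans ?_
  have e : ∑ j, (a • x + b • y) j * l j = a * ∑ j, x j * l j + b * ∑ j, y j * l j := by
    rw [Finset.mul_sum, Finset.mul_sum, ← Finset.sum_add_distrib]
    refine Finset.sum_congr rfl fun j _ => ?_
    simp only [Pi.add_apply, Pi.smul_apply, smul_eq_mul]
    ring
  rw [e]
  exact add_le_add (mul_le_mul_of_nonneg_left hx2 ha) (mul_le_mul_of_nonneg_left hy2 hb)
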